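/- Let w ∈ {1, …, r}. Then a nonnegative integer a is an arithmetic pure gap at the single index (w) (i.e., the 1-tuple (a) is an arithmetic pure gap at (w)) if and only if ⌊r·a/m⌋ − (r−1)·⌈a/m⌉ ≤ −1. -/

import Mathlib

open Finset

/-- Floor of the rational number `x / m`. -/
noncomputable def fdivq (m : ℕ) (x : ℤ) : ℤ := ⌊(x : ℚ) / (m : ℚ)⌋

/-- The quantity `∑_{i=0}^{n-1} ⌊(a_i + t·λ_{c i})/m⌋ + ∑_{w ∉ range c} ⌊t·λ_w/m⌋`. -/
noncomputable def gapSum (m r n : ℕ) (lam : Fin (r + 1) → ℤ)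
    (c : Fin n → Fin (r + 1)) (a : Fin n → ℤ) (t : ℤ) : ℤ :=
  (∑ i : Fin n, fdivq m (a i + t * lam (c i))) +
    ∑ w ∈ Finset.univ \ Finset.image c Finset.univ, fdivq m (t * lam w)

/-- `(a 0, …, a (n-1))` is an *arithmetic pure gap* at the (pairwise distinct) indices
`c 0, …, c (n-1)` of `{0,…,r}`: the entries are nonnegative and for every
`t ∈ {0,…,m-1}` exactly one of the two Bartoli–Quoos–Zini conditions holds. -/
noncomputable def IsArithPureGap (m r n : ℕ) (lam : Fin (r + 1) → ℤ)
    (c : Fin n → Fin (r + 1)) (a : Fin n → ℤ) : Prop :=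
  (∀ i, 0 ≤ a i) ∧
    ∀ t : ℤ, 0 ≤ t → t ≤ (m : ℤ) - 1 →
      Xor' (gapSum m r n lam c a t < 0)
        (0 ≤ gapSum m r n lam c a t ∧
          ∀ i : Fin n, fdivq m (a i + t * lam (c i)) = fdivq m (a i + t * lam (c i) - 1))

theorem fdivq_eq_ediv (m : ℕ) (x : ℤ) : fdivq m x = x / (m : ℤ) := by
  unfold fdivq
  exact Rat.floor_intCast_div_natCast x m

theorem ceil_div_eq_neg_fdivq_neg (m : ℕ) (a : ℤ) :
    ⌈(a : ℚ) / (m : ℚ)⌉ = -fdivq m (-a) := by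
  unfold fdivq
  rw [Int.cast_neg, neg_div, Int.floor_neg, neg_neg]

theorem fdivq_add_mul {m : ℕ} (hm : m ≠ 0) (x k : ℤ) :
    fdivq m (x + m * k) = fdivq m x + k := by
  rw [fdivq_eq_ediv, fdivq_eq_ediv, Int.add_mul_ediv_left _ _ (by exact_mod_cast hm)]

theorem fdivq_eq_fdivq_sub_one_iff {m : ℕ} (hm : m ≠ 0) (x : ℤ) :
    fdivq m x = fdivq m (x - 1) ↔ ¬ (m : ℤ) ∣ x := by
  have hpos : (0 : ℤ) < m := by exact_mod_cast Nat.pos_of_ne_zero hm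
  rw [fdivq_eq_ediv, fdivq_eq_ediv]
  constructor
  · rintro h ⟨k, rfl⟩
    rw [Int.mul_ediv_cancel_left _ hpos.ne', eq_comm, Int.ediv_eq_iff_of_pos hpos] at h
    linarith [h.1]
  · intro h
    rw [eq_comm, Int.ediv_eq_iff_of_pos hpos]
    have hmod : x % m ≠ 0 := fun h0 => h (Int.dvd_of_emod_eq_zero h0)
    have hnonneg := Int.emod_nonneg x hpos.ne'
    have hlt := Int.emod_lt_of_pos x hpos
    have hdiv := Int.mul_ediv_add_emod x m
    have hge : 1 ≤ x % m := by omega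
    constructor <;> linarith

theorem gapSum_single {m r : ℕ} {l : ℤ} {lam : Fin (r + 1) → ℤ}
    (hlam : ∀ i : Fin (r + 1), lam i = if i = 0 then -(r : ℤ) * l else l)
    {w : Fin (r + 1)} (hw : w ≠ 0) (a t : ℤ) :
    gapSum m r 1 lam (fun _ => w) (fun _ => a) t =
      fdivq m (a + t * l) + ((r : ℤ) - 1) * fdivq m (t * l) + fdivq m (-(r : ℤ) * (t * l)) := by
  have hlw : lam w = l := by rw [hlam, if_neg hw]
  have himage : univ \ image (fun _ : Fin 1 => w) univ = univ.erase w := by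
    ext i
    simp [eq_comm]
  have hsum : ∑ i, fdivq m (t * lam i) =
      fdivq m (-(r : ℤ) * (t * l)) + (r : ℤ) * fdivq m (t * l) := by
    simp [Fin.sum_univ_succ, hlam, Fin.succ_ne_zero, mul_left_comm]
  rw [← Finset.add_sum_erase _ _ (mem_univ w), hlw] at hsum
  rw [gapSum, himage, Fin.sum_univ_one]
  simp only [hlw]
  linarith

theorem isArithPureGap_single_iff {m r : ℕ} (hm : m ≠ 0) (lam : Fin (r + 1) → ℤ)
    (w : Fin (r + 1)) {a : ℤ} (ha : 0 ≤ a) :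
    IsArithPureGap m r 1 lam (fun _ => w) (fun _ => a) ↔
      ∀ t : ℤ, 0 ≤ t → t < m → (m : ℤ) ∣ a + t * lam w →
        gapSum m r 1 lam (fun _ => w) (fun _ => a) t < 0 := by
  simp only [IsArithPureGap, ha, implies_true, true_and, fdivq_eq_fdivq_sub_one_iff hm,
    Int.le_sub_one_iff, forall_const]
  refine forall_congr' fun t => forall_congr' fun _ => forall_congr' fun _ => ?_
  change Xor _ _ ↔ _
  rw [xor_def, ← not_lt]
  tauto

theorem gapSum_single_of_dvd {m r : ℕ} (hm : m ≠ 0) {l : ℤ} {lam : Fin (r + 1) → ℤ}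
    (hlam : ∀ i : Fin (r + 1), lam i = if i = 0 then -(r : ℤ) * l else l)
    {w : Fin (r + 1)} (hw : w ≠ 0) {a t : ℤ} (hdvd : (m : ℤ) ∣ a + t * l) :
    gapSum m r 1 lam (fun _ => w) (fun _ => a) t =
      fdivq m ((r : ℤ) * a) - ((r : ℤ) - 1) * ⌈(a : ℚ) / (m : ℚ)⌉ := by
  obtain ⟨k, hk⟩ := hdvd
  have htl : t * l = -a + m * k := by linarith
  have hzero : fdivq m 0 = 0 := by simp [fdivq]
  rw [gapSum_single hlam hw, htl, ceil_div_eq_neg_fdivq_neg, fdivq_add_mul hm,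
    show a + (-a + m * k) = 0 + m * k by ring, fdivq_add_mul hm, hzero,
    show -(r : ℤ) * (-a + m * k) = r * a + m * (-(r * k)) by ring, fdivq_add_mul hm]
  ring

theorem exists_dvd_add_mul_of_isCoprime {m : ℕ} (hm : m ≠ 0) {l : ℤ}
    (h : IsCoprime (m : ℤ) l) (a : ℤ) :
    ∃ t : ℤ, 0 ≤ t ∧ t < m ∧ (m : ℤ) ∣ a + t * l := by
  have hpos : (0 : ℤ) < m := by exact_mod_cast Nat.pos_of_ne_zero hm
  obtain ⟨u, v, huv⟩ := h
  refine ⟨(-a * v) % m, Int.emod_nonneg _ hpos.ne', Int.emod_lt_of_pos _ hpos, ?_⟩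
  refine ⟨a * u - (-a * v) / m * l, ?_⟩
  linear_combination l * Int.emod_add_mul_ediv (-a * v) m - a * huv

/-- For `λ_1 = ⋯ = λ_r = λ`, `λ_0 = −rλ`, `gcd(m, rλ) = 1`:
a nonnegative integer `a` is a gap at a finite index `w ∈ {1,…,r}` iff
`⌊r·a/m⌋ − (r−1)·⌈a/m⌉ ≤ −1`. -/
theorem finite_gap_iff_equal_multiplicities (m r : ℕ) (hm : 2 ≤ m) (hr : 1 ≤ r)
    (l : ℤ) (hl : l ≠ 0) (hgcd : Int.gcd (m : ℤ) ((r : ℤ) * l) = 1)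
    (lam : Fin (r + 1) → ℤ)
    (hlam : ∀ i : Fin (r + 1), lam i = if i = 0 then -(r : ℤ) * l else l)
    (w : Fin (r + 1)) (hw : w ≠ 0)
    (a : ℤ) (ha : 0 ≤ a) :
    IsArithPureGap m r 1 lam (fun _ => w) (fun _ => a) ↔
      fdivq m ((r : ℤ) * a) - ((r : ℤ) - 1) * ⌈(a : ℚ) / (m : ℚ)⌉ ≤ -1 := by
  have hm0 : m ≠ 0 := by omega
  have hlw : lam w = l := by rw [hlam, if_neg hw]
  rw [isArithPureGap_single_iff hm0 lam w ha, hlw]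
  constructor
  · intro h
    obtain ⟨t, ht0, htm, hdvd⟩ := exists_dvd_add_mul_of_isCoprime hm0
      (IsCoprime.of_mul_right_right (Int.isCoprime_iff_gcd_eq_one.mpr hgcd)) a
    have hneg := h t ht0 htm hdvd
    rw [gapSum_single_of_dvd hm0 hlam hw hdvd] at hneg
    omega
  · intro h t _ _ hdvd
    rw [gapSum_single_of_dvd hm0 hlam hw hdvd]
    omega
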